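/- Let G be a finite group and let V and W be modules over a commutative ring R in which the order of G is invertible, each carrying a G-action, and let ⟨−,−⟩ : W × V → R be a G-equivariant pairing (⟨gw, gv⟩ = ⟨w, v⟩ for all g ∈ G) which is perfect in the sense that it is nondegenerate on each side (⟨w, v⟩ = 0 for all v implies w = 0, and ⟨w, v⟩ = 0 for all w implies v = 0). Then the pairing between the coinvariant modules W_G and V_G given by ⟨[w], [v]⟩_G = Σ_{g∈G} ⟨gw, v⟩ is well defined and is again perfect in this sense. -/

import Mathlib

/-- The coinvariants submodule: the submodule generated by the elements `g • m - m`. -/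
def coinvRel (R : Type*) [CommRing R] (G : Type*) [Group G]
    (M : Type*) [AddCommGroup M] [Module R M] [DistribMulAction G M] :
    Submodule R M :=
  Submodule.span R {x | ∃ (g : G) (m : M), x = g • m - m}

/-- The coinvariants `M_G` of a `G`-module. -/
abbrev Coinv (R : Type*) [CommRing R] (G : Type*) [Group G]
    (M : Type*) [AddCommGroup M] [Module R M] [DistribMulAction G M] : Type _ :=
  M ⧸ coinvRel R G M

/-- If the norm of `m` vanishes and `|G|` is invertible, then `m` is zero in the coinvariants. -/
theorem mem_coinvRel_of_sum_eq_zero (R : Type*) [CommRing R] (G : Type*) [Group G] [Fintype G]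
    (M : Type*) [AddCommGroup M] [Module R M] [DistribMulAction G M]
    (hG : IsUnit ((Fintype.card G : ℕ) : R)) (m : M) (h : ∑ g : G, g • m = 0) :
    m ∈ coinvRel R G M := by
  have h1 : ∑ g : G, (g • m - m) ∈ coinvRel R G M :=
    Submodule.sum_mem _ fun g _ => Submodule.subset_span ⟨g, m, rfl⟩
  rw [Finset.sum_sub_distrib, h, zero_sub, neg_mem_iff, Finset.sum_const, Finset.card_univ,
    ← Nat.cast_smul_eq_nsmul R] at h1
  obtain ⟨u, hu⟩ := hG
  have h2 := Submodule.smul_mem _ (↑u⁻¹ : R) h1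
  rwa [← hu, smul_smul, Units.inv_mul, one_smul] at h2

/-- Let `G` be a finite group and `V`, `W` modules over a commutative
ring `R` in which the order of `G` is invertible, each with a `G`-action, and let
`B : W × V → R` be a `G`-equivariant pairing which is nondegenerate on each side.
Then the pairing `⟨[w], [v]⟩_G = Σ_{g ∈ G} ⟨g w, v⟩` on the coinvariants `W_G`, `V_G`
is well defined (it exists as a bilinear map on the quotients) and is again
nondegenerate on each side. -/
theorem statement0 (R : Type*) [CommRing R] (G : Type*) [Group G] [Fintype G]
    (V W : Type*) [AddCommGroup V] [Module R V] [AddCommGroup W] [Module R W]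
    [DistribMulAction G V] [SMulCommClass G R V]
    [DistribMulAction G W] [SMulCommClass G R W]
    (hG : IsUnit ((Fintype.card G : ℕ) : R))
    (B : W →ₗ[R] V →ₗ[R] R)
    (hequiv : ∀ (g : G) (w : W) (v : V), B (g • w) (g • v) = B w v)
    (hW : ∀ w : W, (∀ v : V, B w v = 0) → w = 0)
    (hV : ∀ v : V, (∀ w : W, B w v = 0) → v = 0) :
    ∃ B' : Coinv R G W →ₗ[R] Coinv R G V →ₗ[R] R,
      (∀ (w : W) (v : V),
          B' (Submodule.Quotient.mk w) (Submodule.Quotient.mk v) = ∑ g : G, B (g • w) v) ∧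
      (∀ x : Coinv R G W, (∀ y : Coinv R G V, B' x y = 0) → x = 0) ∧
      (∀ y : Coinv R G V, (∀ x : Coinv R G W, B' x y = 0) → y = 0) := by
  let C : W →ₗ[R] V →ₗ[R] R := ∑ g : G, B ∘ₗ DistribSMul.toLinearMap R W g
  have hC : ∀ w v, C w v = ∑ g : G, B (g • w) v := by
    intro w v
    simp [C, LinearMap.sum_apply]
  have hC' : ∀ w v, C w v = ∑ g : G, B w (g • v) := by
    intro w v
    rw [hC, ← Equiv.sum_comp (Equiv.inv G)]
    refine Finset.sum_congr rfl fun g _ => ?_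
    rw [← hequiv g]
    simp
  have h1 : coinvRel R G W ≤ LinearMap.ker C := by
    refine Submodule.span_le.2 ?_
    rintro _ ⟨h, w, rfl⟩
    rw [SetLike.mem_coe, LinearMap.mem_ker, map_sub, sub_eq_zero]
    ext v
    rw [hC, hC, ← Equiv.sum_comp (Equiv.mulRight h) (fun g => B (g • w) v)]
    simp [mul_smul]
  have h2 : coinvRel R G V ≤ LinearMap.ker ((coinvRel R G W).liftQ C h1).flip := by
    refine Submodule.span_le.2 ?_
    rintro _ ⟨h, v, rfl⟩
    rw [SetLike.mem_coe, LinearMap.mem_ker, map_sub, sub_eq_zero]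
    ext w
    change C w (h • v) = C w v
    rw [hC', hC', ← Equiv.sum_comp (Equiv.mulRight h) (fun g => B w (g • v))]
    simp [mul_smul]
  have key : ∀ (w : W) (v : V), ((coinvRel R G V).liftQ _ h2).flip
      (Submodule.Quotient.mk w) (Submodule.Quotient.mk v) = C w v := fun w v => rfl
  refine ⟨((coinvRel R G V).liftQ _ h2).flip, fun w v => (key w v).trans (hC w v), ?_, ?_⟩
  · intro x hx
    obtain ⟨w, rfl⟩ := Submodule.Quotient.mk_surjective _ x
    rw [Submodule.Quotient.mk_eq_zero]
    refine mem_coinvRel_of_sum_eq_zero R G W hG w (hW _ fun v => ?_)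
    have := hx (Submodule.Quotient.mk v)
    rw [key, hC] at this
    simpa [LinearMap.sum_apply] using this
  · intro y hy
    obtain ⟨v, rfl⟩ := Submodule.Quotient.mk_surjective _ y
    rw [Submodule.Quotient.mk_eq_zero]
    refine mem_coinvRel_of_sum_eq_zero R G V hG v (hV _ fun w => ?_)
    have := hy (Submodule.Quotient.mk w)
    rw [key, hC'] at this
    simpa using this
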